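/- Let k ≥ 1 and let Σ₀, Σ₁ ∈ ℝ^{k×k} be symmetric positive definite matrices such that Σ₁ − Σ₀ is positive definite. Let f₀ and f₁ be the densities of the centered Gaussian distributions on ℝ^k with covariances Σ₀ and Σ₁ respectively, i.e., f_i(y) = (2π)^{−k/2} (det Σ_i)^{−1/2} exp(−(1/2) yᵀ Σ_i^{−1} y). Then ∫_{ℝ^k} f₀(y) · f₁(y)^{−2/(k+2)} dy ≤ (det(2πΣ₁))^{1/(k+2)} · ((k+2)/k)^{k/2} = ∫_{ℝ^k} f₁(y)^{k/(k+2)} dy. -/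

import Mathlib

open MeasureTheory Real Matrix

/-- The density of the centered Gaussian distribution on `ℝ^k` with (positive definite)
covariance matrix `S`: `f(y) = (2π)^{-k/2} (det S)^{-1/2} exp(-(1/2) yᵀ S⁻¹ y)`. -/
noncomputable def gaussDensity {k : ℕ} (S : Matrix (Fin k) (Fin k) ℝ)
    (y : Fin k → ℝ) : ℝ :=
  (2 * π) ^ (-(k : ℝ) / 2) * S.det ^ (-(1 : ℝ) / 2) *
    Real.exp (-(1 / 2) * (y ⬝ᵥ S⁻¹.mulVec y))

lemma gaussDensity_eq {k : ℕ} {S : Matrix (Fin k) (Fin k) ℝ} (hS : S.PosDef) (y : Fin k → ℝ) :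
    gaussDensity S y =
      (((2 * π) • S).det) ^ (-(1 : ℝ) / 2) * Real.exp (-(1 / 2) * (y ⬝ᵥ S⁻¹.mulVec y)) := by
  have hp : (0 : ℝ) ≤ 2 * π := by positivity
  rw [gaussDensity, det_smul, Fintype.card_fin, Real.mul_rpow (by positivity) hS.det_pos.le,
    ← Real.rpow_natCast, ← Real.rpow_mul hp]
  congr 4
  ring

lemma det_two_pi_smul_pos {k : ℕ} {S : Matrix (Fin k) (Fin k) ℝ} (hS : S.PosDef) :
    0 < ((2 * π) • S).det := by
  rw [det_smul]
  exact mul_pos (by positivity) hS.det_pos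

lemma dotProduct_inv_mulVec_le {n : Type*} [Fintype n] [DecidableEq n] {S T : Matrix n n ℝ}
    (hS : S.PosDef) (hT : T.PosDef) (hST : (T - S).PosSemidef) (x : n → ℝ) :
    x ⬝ᵥ T⁻¹.mulVec x ≤ x ⬝ᵥ S⁻¹.mulVec x := by
  have hSu : IsUnit S.det := (isUnit_iff_isUnit_det S).1 hS.isUnit
  have hTu : IsUnit T.det := (isUnit_iff_isUnit_det T).1 hT.isUnit
  set u := T⁻¹.mulVec x with hu
  set v := S⁻¹.mulVec x with hv
  have hSv : S.mulVec v = x := by rw [hv, mulVec_mulVec, mul_nonsing_inv S hSu, one_mulVec]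
  have hTv : T.mulVec u = x := by rw [hu, mulVec_mulVec, mul_nonsing_inv T hTu, one_mulVec]
  have h1 := hS.posSemidef.dotProduct_mulVec_nonneg (v - u)
  have h2 := hST.dotProduct_mulVec_nonneg u
  have hsymm : v ⬝ᵥ S.mulVec u = x ⬝ᵥ u := by
    have hSt : Sᵀ = S := hS.isHermitian.eq
    rw [dotProduct_mulVec, ← mulVec_transpose, hSt, hSv]
  simp only [star_trivial, mulVec_sub, sub_mulVec, dotProduct_sub, sub_dotProduct, hSv, hTv,
    hsymm] at h1 h2
  rw [dotProduct_comm v x, dotProduct_comm u x] at h1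
  rw [dotProduct_comm u x] at h2
  linarith

lemma integral_exp_neg_mul_dotProduct_self {n : Type*} [Fintype n] (b : ℝ) :
    ∫ y : n → ℝ, Real.exp (-b * (y ⬝ᵥ y)) = √(π / b) ^ Fintype.card n := by
  have h : ∀ y : n → ℝ, Real.exp (-b * (y ⬝ᵥ y)) = ∏ i, Real.exp (-b * y i ^ 2) := by
    intro y
    rw [← Real.exp_sum, dotProduct, Finset.mul_sum]
    simp only [pow_two]
  simp_rw [h]
  rw [integral_fintype_prod_volume_eq_pow (fun t : ℝ => Real.exp (-b * t ^ 2)), integral_gaussian]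

open scoped MatrixOrder in
lemma integral_exp_neg_inv_mulVec {k : ℕ} {S : Matrix (Fin k) (Fin k) ℝ} (hS : S.PosDef)
    {b : ℝ} (hb : 0 < b) :
    ∫ y : Fin k → ℝ, Real.exp (-(b / 2) * (y ⬝ᵥ S⁻¹.mulVec y)) =
      b ^ (-(k : ℝ) / 2) * (((2 * π) • S).det) ^ ((1 : ℝ) / 2) := by
  obtain ⟨B, hB⟩ := CStarAlgebra.nonneg_iff_eq_star_mul_self.1 hS.inv.posSemidef.nonneg
  rw [star_eq_conjTranspose] at hB
  have hdet : B.det ^ 2 = S.det⁻¹ := by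
    have h := congrArg det hB
    rw [det_mul, det_conjTranspose, star_trivial, det_nonsing_inv, Ring.inverse_eq_inv'] at h
    rw [h, pow_two]
  have hB0 : B.det ≠ 0 := by
    intro h0
    rw [h0] at hdet
    exact (inv_pos.2 hS.det_pos).ne' (by simpa using hdet.symm)
  have hq : ∀ y : Fin k → ℝ, y ⬝ᵥ S⁻¹.mulVec y = B.mulVec y ⬝ᵥ B.mulVec y := by
    intro y
    rw [hB, ← mulVec_mulVec, dotProduct_mulVec, conjTranspose_eq_transpose_of_trivial,
      vecMul_transpose]
  have hmap := Real.map_matrix_volume_pi_eq_smul_volume_pi hB0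
  have hintegral : ∫ y : Fin k → ℝ, Real.exp (-(b / 2) * (B.mulVec y ⬝ᵥ B.mulVec y)) =
      |B.det⁻¹| * √(π / (b / 2)) ^ k := by
    have hcont : Continuous fun y : Fin k → ℝ => Real.exp (-(b / 2) * (y ⬝ᵥ y)) := by
      unfold dotProduct; fun_prop
    have h := integral_map (μ := volume) (φ := toLin' B)
      (LinearMap.continuous_of_finiteDimensional _).measurable.aemeasurable
      (f := fun y : Fin k → ℝ => Real.exp (-(b / 2) * (y ⬝ᵥ y)))
      hcont.aestronglyMeasurable
    rw [hmap, integral_smul_measure, integral_exp_neg_mul_dotProduct_self,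
      ENNReal.toReal_ofReal (abs_nonneg _), Fintype.card_fin] at h
    simpa only [toLin'_apply, smul_eq_mul] using h.symm
  have habs : |B.det⁻¹| = S.det ^ ((1 : ℝ) / 2) := by
    rw [← Real.sqrt_eq_rpow, ← Real.sqrt_sq_eq_abs, inv_pow, hdet, inv_inv]
  simp_rw [hq]
  rw [hintegral, habs, det_smul, Fintype.card_fin, Real.mul_rpow (by positivity) hS.det_pos.le,
    ← Real.rpow_natCast, ← Real.rpow_natCast, Real.sqrt_eq_rpow,
    show π / (b / 2) = b⁻¹ * (2 * π) by field_simp, ← Real.rpow_mul (by positivity),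
    ← Real.rpow_mul (by positivity), Real.mul_rpow (by positivity) (by positivity),
    Real.inv_rpow hb.le, ← Real.rpow_neg hb.le]
  ring_nf

lemma integrable_exp_neg_inv_mulVec {k : ℕ} {S : Matrix (Fin k) (Fin k) ℝ} (hS : S.PosDef)
    {b : ℝ} (hb : 0 < b) :
    Integrable fun y : Fin k → ℝ => Real.exp (-(b / 2) * (y ⬝ᵥ S⁻¹.mulVec y)) := by
  refine not_imp_comm.1 integral_undef ?_
  rw [integral_exp_neg_inv_mulVec hS hb]
  have := det_two_pi_smul_pos hS
  positivity

/-- The mismatched-density integral inequality (equation (29)) of Proposition 1: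
if `Σ₀, Σ₁` are symmetric positive definite with `Σ₁ − Σ₀` positive definite, then
`∫ f₀ f₁^{−2/(k+2)} ≤ (det(2πΣ₁))^{1/(k+2)} ((k+2)/k)^{k/2} = ∫ f₁^{k/(k+2)}`. -/
theorem stmt11 {k : ℕ} (hk : 1 ≤ k) (S₀ S₁ : Matrix (Fin k) (Fin k) ℝ)
    (h₀ : S₀.PosDef) (h₁ : S₁.PosDef) (hd : (S₁ - S₀).PosDef) :
    (∫ y : Fin k → ℝ,
        gaussDensity S₀ y * (gaussDensity S₁ y) ^ (-(2 : ℝ) / ((k : ℝ) + 2))) ≤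
      (((2 * π) • S₁).det) ^ ((1 : ℝ) / ((k : ℝ) + 2)) *
        (((k : ℝ) + 2) / (k : ℝ)) ^ ((k : ℝ) / 2) ∧
    (((2 * π) • S₁).det) ^ ((1 : ℝ) / ((k : ℝ) + 2)) *
        (((k : ℝ) + 2) / (k : ℝ)) ^ ((k : ℝ) / 2) =
      ∫ y : Fin k → ℝ, (gaussDensity S₁ y) ^ ((k : ℝ) / ((k : ℝ) + 2)) := by
  have hk0 : (0 : ℝ) < k := by exact_mod_cast hk
  have hb : (0 : ℝ) < k / (k + 2) := by positivity
  have hD₀ := det_two_pi_smul_pos h₀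
  have hD₁ := det_two_pi_smul_pos h₁
  have hpow : ∀ (r : ℝ) (y : Fin k → ℝ), gaussDensity S₁ y ^ r =
      (((2 * π) • S₁).det) ^ (-r / 2) * Real.exp (-(r / 2) * (y ⬝ᵥ S₁⁻¹.mulVec y)) := by
    intro r y
    rw [gaussDensity_eq h₁, Real.mul_rpow (by positivity) (by positivity),
      ← Real.rpow_mul hD₁.le, ← Real.exp_mul]
    ring_nf
  have hinv : ((k : ℝ) / (k + 2)) ^ (-(k : ℝ) / 2) = (((k : ℝ) + 2) / k) ^ ((k : ℝ) / 2) := by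
    rw [neg_div, Real.rpow_neg hb.le, ← Real.inv_rpow hb.le, inv_div]
  constructor
  · have hbound : ∀ y : Fin k → ℝ,
        gaussDensity S₀ y * gaussDensity S₁ y ^ (-(2 : ℝ) / ((k : ℝ) + 2)) ≤
          (((2 * π) • S₀).det ^ (-(1 : ℝ) / 2) *
            ((2 * π) • S₁).det ^ ((1 : ℝ) / ((k : ℝ) + 2))) *
          Real.exp (-((k : ℝ) / (k + 2) / 2) * (y ⬝ᵥ S₀⁻¹.mulVec y)) := by
      intro y
      have hle := dotProduct_inv_mulVec_le h₀ h₁ hd.posSemidef y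
      rw [hpow, gaussDensity_eq h₀, mul_mul_mul_comm, ← Real.exp_add,
        show -(-(2 : ℝ) / ((k : ℝ) + 2)) / 2 = 1 / ((k : ℝ) + 2) by ring]
      gcongr
      have hmul := mul_le_mul_of_nonneg_left hle
        (show (0 : ℝ) ≤ 1 / ((k : ℝ) + 2) by positivity)
      rw [show (k : ℝ) / (k + 2) / 2 = 1 / 2 - 1 / (k + 2) by field_simp; ring,
        show -(2 : ℝ) / ((k : ℝ) + 2) / 2 = -(1 / ((k : ℝ) + 2)) by ring]
      linarith
    have hnonneg : ∀ y : Fin k → ℝ,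
        0 ≤ gaussDensity S₀ y * gaussDensity S₁ y ^ (-(2 : ℝ) / ((k : ℝ) + 2)) := by
      intro y
      rw [hpow, gaussDensity_eq h₀]
      positivity
    refine (integral_mono_of_nonneg (.of_forall hnonneg)
      ((integrable_exp_neg_inv_mulVec h₀ hb).const_mul _) (.of_forall hbound)).trans_eq ?_
    have hcancel :
        ((2 * π) • S₀).det ^ (-(1 : ℝ) / 2) * ((2 * π) • S₀).det ^ ((1 : ℝ) / 2) = 1 := by
      rw [← Real.rpow_add hD₀, neg_div, neg_add_cancel, Real.rpow_zero]
    rw [integral_const_mul, integral_exp_neg_inv_mulVec h₀ hb, hinv]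
    linear_combination (((2 * π) • S₁).det ^ ((1 : ℝ) / ((k : ℝ) + 2)) *
      (((k : ℝ) + 2) / k) ^ ((k : ℝ) / 2)) * hcancel
  · simp_rw [hpow]
    rw [integral_const_mul, integral_exp_neg_inv_mulVec h₁ hb, hinv, mul_left_comm,
      ← Real.rpow_add hD₁, mul_comm]
    congr 2
    field_simp
    ring
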